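/- Dense-regime detection boundary (Gaussian case). Let 0 < δ ≤ 1/2 and 0 < r < 1/2 with r < r*(δ) := 1/4 - δ/2. Let ε_n and τ_n be sequences with ε_n/n^{-δ} → 1 and τ_n/n^{-r} → 1 as n → ∞, and set f_n(x) = (1-ε_n)φ_G(x-μ₁) + ε_n φ_G(x-μ₂) with μ₂-μ₁ = τ_n (μ₁ arbitrary). Let α ∈ (0,1) and β ∈ (0,1-α). Then for n large enough, P_{f_n}(Ψ_α = 0) ≤ β and P_{f_n}(ψ_α = 0) ≤ β, where Ψ_α is the order-statistics spacing test and ψ_α is the variance test. Conversely, if r > r*(δ), no sequence of level-α tests can have second kind error at most β at f_n for all large n (detection is impossible). -/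

import Mathlib

open MeasureTheory Filter Set

noncomputable section

/-- The measure on `ℝ` with Lebesgue density `f`. -/
def pdfMeasure (f : ℝ → ℝ) : Measure ℝ :=
  MeasureTheory.volume.withDensity (fun x => ENNReal.ofReal (f x))

/-- The joint law of `n` i.i.d. observations with common density `f`. -/
def sampleMeasure (n : ℕ) (f : ℝ → ℝ) : Measure (Fin n → ℝ) :=
  Measure.pi (fun _ : Fin n => pdfMeasure f)

/-- The `k`-th order statistic (for `1 ≤ k ≤ n`) of the sample `ω`. -/
def oStat {n : ℕ} (k : ℕ) (ω : Fin n → ℝ) : ℝ :=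
  if h : 1 ≤ k ∧ k ≤ n then ω (Tuple.sort ω ⟨k - 1, by omega⟩) else 0

/-- The spacing `X_{(n-k+1)} - X_{(k)}` of the order statistics. -/
def spacing {n : ℕ} (k : ℕ) (ω : Fin n → ℝ) : ℝ :=
  oStat (n - k + 1) ω - oStat k ω

/-- `K_n = {2^j : 0 ≤ j ≤ ⌊log₂ (n/2)⌋}`. -/
def Kfin (n : ℕ) : Finset ℕ :=
  (Finset.range (Nat.log 2 (n / 2) + 1)).image (fun j => 2 ^ j)

/-- The `(1-u)`-quantile of the spacing `X_{(n-k+1)} - X_{(k)}` under the null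
hypothesis (sample of density `φ`; under `H₀` this law does not depend on the
translation parameter). -/
def spacingQuantile (n : ℕ) (φ : ℝ → ℝ) (u : ℝ) (k : ℕ) : ℝ :=
  sInf {t : ℝ | sampleMeasure n φ {ω | spacing k ω > t} ≤ ENNReal.ofReal u}

/-- The corrected level `α_n`. -/
def alphaN (n : ℕ) (φ : ℝ → ℝ) (α : ℝ) : ℝ :=
  sSup {u : ℝ | u ∈ Set.Ioo (0:ℝ) 1 ∧
    sampleMeasure n φ {ω | ∃ k ∈ Kfin n, spacing k ω > spacingQuantile n φ u k}
      ≤ ENNReal.ofReal α}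

/-- The rejection region of the multiple spacing test `Ψ_α`. -/
def psiReject (n : ℕ) (φ : ℝ → ℝ) (α : ℝ) : Set (Fin n → ℝ) :=
  {ω | ∃ k ∈ Kfin n, spacing k ω > spacingQuantile n φ (alphaN n φ α) k}

/-- The empirical (unbiased) variance `S_n²`. -/
def varStat {n : ℕ} (ω : Fin n → ℝ) : ℝ :=
  (∑ i, (ω i - (∑ j, ω j) / (n : ℝ)) ^ 2) / ((n : ℝ) - 1)

/-- The `(1-α)`-quantile of `S_n²` under the null hypothesis. -/
def varQuantile (n : ℕ) (φ : ℝ → ℝ) (α : ℝ) : ℝ :=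
  sInf {t : ℝ | sampleMeasure n φ {ω | varStat ω > t} ≤ ENNReal.ofReal α}

/-- The standard Gaussian density. -/
def phiG (x : ℝ) : ℝ := (Real.sqrt (2 * Real.pi))⁻¹ * Real.exp (-x ^ 2 / 2)

/-- A two-component Gaussian mixture density. -/
def mixG (ε μ₁ μ₂ : ℝ) : ℝ → ℝ := fun x => (1 - ε) * phiG (x - μ₁) + ε * phiG (x - μ₂)

/-- Survival function `Φ̄ = 1 - Φ` of the density `φ`. -/
def Phibar (φ : ℝ → ℝ) (u : ℝ) : ℝ := 1 - ∫ x in Set.Iic u, φ x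

/-- The standard Laplace density. -/
def phiL (x : ℝ) : ℝ := (1 / 2) * Real.exp (-|x|)

/-- A two-component Laplace mixture density. -/
def mixL (ε μ₁ μ₂ : ℝ) : ℝ → ℝ := fun x => (1 - ε) * phiL (x - μ₁) + ε * phiL (x - μ₂)

/-- The threshold `ρ(k,n) = k/n + (1 + √(1+2kβ))/(nβ)`. -/
def rhoKn (n k : ℕ) (β : ℝ) : ℝ :=
  ((k : ℝ) / (n : ℝ)) + (1 + Real.sqrt (1 + 2 * (k : ℝ) * β)) / ((n : ℝ) * β)

open ProbabilityTheory
open scoped ENNReal NNReal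

lemma phiG_sub_eq_gaussianPDFReal (μ x : ℝ) : phiG (x - μ) = gaussianPDFReal μ 1 x := by
  simp [phiG, gaussianPDFReal]

lemma pdfMeasure_phiG_sub (μ : ℝ) : pdfMeasure (fun x => phiG (x - μ)) = gaussianReal μ 1 := by
  rw [gaussianReal_of_var_ne_zero _ one_ne_zero, pdfMeasure]
  simp only [phiG_sub_eq_gaussianPDFReal]
  rfl

lemma pdfMeasure_phiG : pdfMeasure phiG = gaussianReal 0 1 := by
  simpa using pdfMeasure_phiG_sub 0

lemma pdfMeasure_mixG {ε : ℝ} (hε : ε ∈ Ioo (0 : ℝ) 1) (a b : ℝ) :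
    pdfMeasure (mixG ε a b) =
      ENNReal.ofReal (1 - ε) • gaussianReal a 1 + ENNReal.ofReal ε • gaussianReal b 1 := by
  have h0 : 0 ≤ 1 - ε := by linarith [hε.2]
  have h1 : 0 ≤ ε := hε.1.le
  rw [gaussianReal_of_var_ne_zero _ one_ne_zero, gaussianReal_of_var_ne_zero _ one_ne_zero,
    ← withDensity_smul _ (measurable_gaussianPDF _ _),
    ← withDensity_smul _ (measurable_gaussianPDF _ _),
    ← withDensity_add_left ((measurable_gaussianPDF _ _).const_smul _), pdfMeasure]
  congr 1
  ext x
  simp only [mixG, phiG_sub_eq_gaussianPDFReal, Pi.add_apply, Pi.smul_apply, smul_eq_mul,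
    gaussianPDF]
  rw [ENNReal.ofReal_add (mul_nonneg h0 (gaussianPDFReal_nonneg _ _ _))
    (mul_nonneg h1 (gaussianPDFReal_nonneg _ _ _)), ENNReal.ofReal_mul h0, ENNReal.ofReal_mul h1]

lemma isProbabilityMeasure_mixG {ε : ℝ} (hε : ε ∈ Ioo (0 : ℝ) 1) (a b : ℝ) :
    IsProbabilityMeasure (pdfMeasure (mixG ε a b)) := by
  rw [pdfMeasure_mixG hε]
  constructor
  simp only [Measure.coe_add, Measure.coe_smul, Pi.add_apply, Pi.smul_apply, measure_univ,
    smul_eq_mul, mul_one]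
  rw [← ENNReal.ofReal_add (by linarith [hε.2]) hε.1.le]
  simp

lemma integral_mixG {ε : ℝ} (hε : ε ∈ Ioo (0 : ℝ) 1) (a b : ℝ) {g : ℝ → ℝ}
    (ha : Integrable g (gaussianReal a 1)) (hb : Integrable g (gaussianReal b 1)) :
    ∫ x, g x ∂(pdfMeasure (mixG ε a b)) =
      (1 - ε) * ∫ x, g x ∂(gaussianReal a 1) + ε * ∫ x, g x ∂(gaussianReal b 1) := by
  rw [pdfMeasure_mixG hε, integral_add_measure (ha.smul_measure ENNReal.ofReal_ne_top)
    (hb.smul_measure ENNReal.ofReal_ne_top), integral_smul_measure, integral_smul_measure,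
    ENNReal.toReal_ofReal (by linarith [hε.2]), ENNReal.toReal_ofReal hε.1.le]
  rfl

lemma memLp_two_mixG {ε : ℝ} (hε : ε ∈ Ioo (0 : ℝ) 1) (a b : ℝ) {g : ℝ → ℝ}
    (hg : Measurable g) (ha : MemLp g 2 (gaussianReal a 1)) (hb : MemLp g 2 (gaussianReal b 1)) :
    MemLp g 2 (pdfMeasure (mixG ε a b)) := by
  rw [memLp_two_iff_integrable_sq hg.aestronglyMeasurable, pdfMeasure_mixG hε]
  exact (ha.integrable_sq.smul_measure ENNReal.ofReal_ne_top).add_measure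
    (hb.integrable_sq.smul_measure ENNReal.ofReal_ne_top)

lemma measureReal_mixG {ε : ℝ} (hε : ε ∈ Ioo (0 : ℝ) 1) (a b : ℝ) (s : Set ℝ) :
    (pdfMeasure (mixG ε a b)).real s =
      (1 - ε) * (gaussianReal a 1).real s + ε * (gaussianReal b 1).real s := by
  rw [pdfMeasure_mixG hε, measureReal_add_apply
    (by simp [ENNReal.mul_eq_top]) (by simp [ENNReal.mul_eq_top]),
    measureReal_ennreal_smul_apply, measureReal_ennreal_smul_apply,
    ENNReal.toReal_ofReal (by linarith [hε.2]), ENNReal.toReal_ofReal hε.1.le]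

/-- The Chebyshev inequality for an empirical mean. -/
lemma pi_sum_chebyshev (ν : Measure ℝ) [IsProbabilityMeasure ν] {n : ℕ} (hn : 0 < n) {g : ℝ → ℝ}
    (hg : MemLp g 2 ν) {V : ℝ} (hV : Var[g; ν] ≤ V) {s : ℝ} (hs : 0 < s) :
    Measure.pi (fun _ : Fin n => ν) {ω | n * s ≤ |∑ i, g (ω i) - n * ∫ x, g x ∂ν|} ≤
      ENNReal.ofReal (V / (n * s ^ 2)) := by
  have hn' : (0 : ℝ) < n := by exact_mod_cast hn
  have hmp : ∀ i : Fin n, MeasurePreserving (Function.eval i) (Measure.pi (fun _ : Fin n => ν)) ν :=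
    fun i => measurePreserving_eval _ i
  have hi : ∀ i : Fin n, MemLp (fun ω : Fin n → ℝ => g (ω i)) 2 (Measure.pi (fun _ => ν)) :=
    fun i => hg.comp_measurePreserving (hmp i)
  have hX : MemLp (fun ω : Fin n → ℝ => ∑ i, g (ω i)) 2 (Measure.pi (fun _ => ν)) :=
    memLp_finsetSum _ fun i _ => hi i
  have hE : ∫ ω : Fin n → ℝ, ∑ i, g (ω i) ∂(Measure.pi (fun _ => ν)) = n * ∫ x, g x ∂ν := by
    rw [integral_finsetSum _ fun i _ => (hi i).integrable (by norm_num)]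
    have : ∀ i : Fin n, ∫ ω : Fin n → ℝ, g (ω i) ∂(Measure.pi (fun _ => ν)) = ∫ x, g x ∂ν :=
      fun i => integral_comp_eval (μ := fun _ : Fin n => ν) (i := i) hg.1
    simp [this]
  have hvar : Var[fun ω : Fin n → ℝ => ∑ i, g (ω i); Measure.pi (fun _ => ν)] =
      n * Var[g; ν] := by
    have := variance_sum_pi (μ := fun _ : Fin n => ν) (X := fun _ => g) fun _ => hg
    simp only [Finset.sum_const, Finset.card_univ, Fintype.card_fin, nsmul_eq_mul] at this
    rw [← this]
    congr 1
    ext ω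
    simp
  have := meas_ge_le_variance_div_sq hX (mul_pos hn' hs)
  rw [hE, hvar] at this
  refine this.trans (ENNReal.ofReal_le_ofReal ?_)
  rw [div_le_div_iff₀ (by positivity) (by positivity)]
  have : 0 ≤ (V - Var[g; ν]) * (n * (n * s ^ 2)) := mul_nonneg (by linarith) (by positivity)
  nlinarith

lemma memLp_sub_pow_gaussianReal (a m : ℝ) (k : ℕ) {p : ℝ≥0} :
    MemLp (fun x => (x - m) ^ k) p (gaussianReal a 1) := by
  rcases Nat.eq_zero_or_pos k with rfl | hk
  · simpa using memLp_const _
  have h : MemLp (fun x : ℝ => x - m) ((k * p : ℝ≥0) : ℝ≥0∞) (gaussianReal a 1) :=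
    (memLp_id_gaussianReal (k * p)).sub (memLp_const m)
  have hk' : (k : ℝ≥0∞) ≠ 0 := by exact_mod_cast hk.ne'
  have h2 := h.norm_rpow_div (k : ℝ≥0∞)
  have he : ((k * p : ℝ≥0) : ℝ≥0∞) / (k : ℝ≥0∞) = p := by
    push_cast
    rw [mul_comm, ENNReal.mul_div_cancel_right hk' (by simp)]
  rw [he] at h2
  refine h2.of_le (by fun_prop) (ae_of_all _ fun x => ?_)
  simp

lemma integrable_sub_pow_gaussianReal (a m : ℝ) (k : ℕ) :
    Integrable (fun x => (x - m) ^ k) (gaussianReal a 1) := by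
  have := memLp_sub_pow_gaussianReal a m k (p := 1)
  exact memLp_one_iff_integrable.1 (by simpa using this)

lemma integral_sub_gaussianReal (a m : ℝ) : ∫ x, (x - m) ∂(gaussianReal a 1) = a - m := by
  have hi : Integrable (fun x : ℝ => x) (gaussianReal a 1) := by
    simpa using integrable_sub_pow_gaussianReal a 0 1
  rw [integral_sub hi (integrable_const _), integral_id_gaussianReal]
  simp

lemma integral_sub_sq_gaussianReal (a m : ℝ) :
    ∫ x, (x - m) ^ 2 ∂(gaussianReal a 1) = 1 + (a - m) ^ 2 := by
  have hv := variance_fun_id_gaussianReal (μ := a) (v := 1)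
  rw [variance_eq_integral (by fun_prop), integral_id_gaussianReal] at hv
  have h1 : (fun x : ℝ => (x - m) ^ 2) =
      fun x => (x - a) ^ 2 + 2 * (a - m) * (x - a) + (a - m) ^ 2 := by
    ext x; ring
  have hi : Integrable (fun x : ℝ => x - a) (gaussianReal a 1) := by
    simpa using integrable_sub_pow_gaussianReal a a 1
  rw [h1, integral_add (by
    exact (integrable_sub_pow_gaussianReal a a 2).add (hi.const_mul _)) (integrable_const _),
    integral_add (integrable_sub_pow_gaussianReal a a 2) (hi.const_mul _), hv,
    integral_const_mul, integral_sub_gaussianReal]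
  simp

lemma exists_integral_sub_pow_four_gaussianReal_le :
    ∃ C : ℝ, 0 < C ∧ ∀ a m : ℝ, |a - m| ≤ 1 → ∫ x, (x - m) ^ 4 ∂(gaussianReal a 1) ≤ C := by
  have h0 : 0 ≤ ∫ x, (x - 0) ^ 4 ∂(gaussianReal 0 1) := integral_nonneg fun x => by positivity
  refine ⟨8 * (∫ x, (x - 0) ^ 4 ∂(gaussianReal 0 1)) + 8, by linarith, fun a m h => ?_⟩
  have hmap := gaussianReal_map_add_const (μ := 0) (v := 1) a
  rw [zero_add] at hmap
  rw [← hmap, integral_map (by fun_prop) (by fun_prop)]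
  have hi := (integrable_sub_pow_gaussianReal 0 0 4).const_mul 8
  calc ∫ x, (x + a - m) ^ 4 ∂(gaussianReal 0 1)
      ≤ ∫ x, (8 * (x - 0) ^ 4 + 8) ∂(gaussianReal 0 1) := by
        refine integral_mono_of_nonneg (ae_of_all _ fun x => by positivity)
          (hi.add (integrable_const _)) (ae_of_all _ fun x => ?_)
        simp only [sub_zero]
        set y := a - m with hy
        have hy2 : y ^ 2 ≤ 1 := by rw [← sq_abs]; nlinarith [abs_nonneg y]
        have e : x + a - m = x + y := by rw [hy]; ring
        rw [e]
        have h1 : (x + y) ^ 2 ≤ 2 * x ^ 2 + 2 := by nlinarith [sq_nonneg (x - y)]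
        nlinarith [sq_nonneg (x + y), sq_nonneg (x ^ 2 - 1)]
    _ = _ := by
        rw [integral_add hi (integrable_const _), integral_const_mul]
        simp

lemma varStat_nonneg {n : ℕ} (hn : 1 ≤ n) (ω : Fin n → ℝ) : 0 ≤ varStat ω := by
  have : (1 : ℝ) ≤ n := by exact_mod_cast hn
  exact div_nonneg (Finset.sum_nonneg fun i _ => sq_nonneg _) (by linarith)

lemma isProbabilityMeasure_sampleMeasure {n : ℕ} {f : ℝ → ℝ} [IsProbabilityMeasure (pdfMeasure f)] :
    IsProbabilityMeasure (sampleMeasure n f) := by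
  unfold sampleMeasure
  infer_instance

instance : IsProbabilityMeasure (pdfMeasure phiG) := by
  rw [pdfMeasure_phiG]
  infer_instance

/-- An upper bound for the quantile of a nonnegative statistic. -/
lemma sInf_quantile_le {Ω : Type*} [MeasurableSpace Ω] {P : Measure Ω} [IsProbabilityMeasure P]
    {X : Ω → ℝ} (hX : ∀ ω, 0 ≤ X ω) {u t : ℝ} (ht : 0 ≤ t)
    (h : P {ω | X ω > t} ≤ ENNReal.ofReal u) :
    sInf {t : ℝ | P {ω | X ω > t} ≤ ENNReal.ofReal u} ≤ t := by
  rcases lt_or_ge u 1 with hu | hu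
  · refine csInf_le ⟨0, fun s hs => ?_⟩ h
    by_contra! hs0
    have : {ω | X ω > s} = univ := eq_univ_of_forall fun ω => hs0.trans_le (hX ω)
    rw [mem_ofPred_eq, this, measure_univ] at hs
    exact absurd hs (not_le.2 (by simpa using hu))
  · have : {t : ℝ | P {ω | X ω > t} ≤ ENNReal.ofReal u} = univ :=
      eq_univ_of_forall fun s => prob_le_one.trans (by simpa using hu)
    rwa [this, Real.sInf_univ]

lemma sum_sub_mean_sq {n : ℕ} (hn : 0 < n) (ω : Fin n → ℝ) (m : ℝ) :
    ∑ i, (ω i - (∑ j, ω j) / (n : ℝ)) ^ 2 =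
      ∑ i, (ω i - m) ^ 2 - (∑ i, (ω i - m)) ^ 2 / n := by
  have hn' : (n : ℝ) ≠ 0 := by exact_mod_cast hn.ne'
  set S := ∑ j, ω j with hS
  have h1 : ∀ c : ℝ, ∑ i, (ω i - c) ^ 2 = ∑ i, ω i ^ 2 - 2 * c * S + n * c ^ 2 := by
    intro c
    simp only [sub_sq, Finset.sum_add_distrib, Finset.sum_sub_distrib, ← Finset.sum_mul,
      ← Finset.mul_sum, ← hS, Finset.sum_const, Finset.card_univ, Fintype.card_fin, nsmul_eq_mul]
    ring
  rw [h1, h1, Finset.sum_sub_distrib, ← hS]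
  simp only [Finset.sum_const, Finset.card_univ, Fintype.card_fin, nsmul_eq_mul]
  field_simp
  ring

lemma exists_varStat_error_le : ∃ C : ℝ, 0 < C ∧ ∀ n : ℕ, 2 ≤ n → ∀ ε τ μ α D : ℝ,
    ε ∈ Ioo (0 : ℝ) 1 → 0 < τ → τ ≤ 1 → α < 1 → D = ε * (1 - ε) * τ ^ 2 →
    C / (n * D ^ 2) ≤ α →
    sampleMeasure n (mixG ε μ (μ + τ)) {ω | varStat ω ≤ varQuantile n phiG α} ≤
      ENNReal.ofReal (C / (n * D ^ 2)) := by
  obtain ⟨C₄, hC₄, h4⟩ := exists_integral_sub_pow_four_gaussianReal_le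
  refine ⟨64 * C₄ + 10, by linarith, fun n hn ε τ μ α D hε hτ0 hτ1 hα hD hsmall => ?_⟩
  have hn0 : 0 < n := by omega
  have hn' : (2 : ℝ) ≤ n := by exact_mod_cast hn
  have hε1 : 0 < 1 - ε := by linarith [hε.2]
  have hD0 : 0 < D := by rw [hD]; exact mul_pos (mul_pos hε.1 hε1) (by positivity)
  have hD1 : D ≤ 1 := by
    have : ε * (1 - ε) ≤ 1 := by nlinarith [hε.1]
    have : τ ^ 2 ≤ 1 := by nlinarith
    have := mul_pos hε.1 hε1
    rw [hD]; nlinarith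
  have hnD : 10 ≤ n * D := by
    have h1 : (64 * C₄ + 10) / (n * D ^ 2) ≤ 1 := hsmall.trans hα.le
    rw [div_le_one (by positivity)] at h1
    have : n * D ^ 2 ≤ n * D := by nlinarith [mul_pos (show (0 : ℝ) < n by linarith) hD0]
    linarith
  have hq : varQuantile n phiG α ≤ 1 + D / 4 := by
    have := isProbabilityMeasure_sampleMeasure (n := n) (f := phiG)
    refine sInf_quantile_le (varStat_nonneg (by omega)) (by positivity) ?_
    have hmem : MemLp (fun x : ℝ => (x - 0) ^ 2) 2 (pdfMeasure phiG) := by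
      rw [pdfMeasure_phiG]; exact memLp_sub_pow_gaussianReal 0 0 2
    have hVar : Var[fun x : ℝ => (x - 0) ^ 2; pdfMeasure phiG] ≤ C₄ := by
      refine (variance_le_expectation_sq (by fun_prop)).trans ?_
      have := h4 0 0 (by simp)
      rw [pdfMeasure_phiG]
      simpa [← pow_mul] using this
    have hch := pi_sum_chebyshev (pdfMeasure phiG) hn0 hmem hVar (s := D / 8) (by positivity)
    have hmom : ∫ x : ℝ, (x - 0) ^ 2 ∂(pdfMeasure phiG) = 1 := by
      rw [pdfMeasure_phiG, integral_sub_sq_gaussianReal]; simp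
    rw [hmom] at hch
    refine (measure_mono fun ω hω => ?_).trans (hch.trans (ENNReal.ofReal_le_ofReal ?_))
    · simp only [mem_ofPred_eq, gt_iff_lt] at hω ⊢
      rw [varStat, lt_div_iff₀ (by linarith), sum_sub_mean_sq hn0 ω 0] at hω
      refine le_trans ?_ (le_abs_self _)
      have : 0 ≤ (∑ i, (ω i - 0)) ^ 2 / n := by positivity
      nlinarith
    · refine le_trans ?_ hsmall
      rw [div_le_div_iff₀ (by positivity) (by positivity)]
      have : 0 < (n : ℝ) * D ^ 2 := by positivity
      nlinarith
  have := isProbabilityMeasure_mixG hε μ (μ + τ)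
  set ν := pdfMeasure (mixG ε μ (μ + τ)) with hν
  set m := μ + ε * τ with hm
  have ha : |μ - m| ≤ 1 := by
    rw [hm, abs_le]; constructor <;> nlinarith [hε.1, hε.2, mul_pos hε.1 hτ0]
  have hb : |μ + τ - m| ≤ 1 := by
    rw [hm, abs_le]; constructor <;> nlinarith [hε.1, hε.2, mul_pos hε.1 hτ0]
  have hmem1 : MemLp (fun x : ℝ => x - m) 2 ν := by
    have h : ∀ c, MemLp (fun x : ℝ => x - m) 2 (gaussianReal c 1) := fun c => by
      simpa using memLp_sub_pow_gaussianReal c m 1 (p := 2)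
    exact memLp_two_mixG hε _ _ (by fun_prop) (h _) (h _)
  have hmem2 : MemLp (fun x : ℝ => (x - m) ^ 2) 2 ν :=
    memLp_two_mixG hε _ _ (by fun_prop) (memLp_sub_pow_gaussianReal _ _ _)
      (memLp_sub_pow_gaussianReal _ _ _)
  have hint1 : ∫ x, (x - m) ∂ν = 0 := by
    have h : ∀ c, Integrable (fun x : ℝ => x - m) (gaussianReal c 1) := fun c => by
      simpa using integrable_sub_pow_gaussianReal c m 1
    rw [hν, integral_mixG hε _ _ (h _) (h _), integral_sub_gaussianReal,
      integral_sub_gaussianReal, hm]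
    ring
  have hint2 : ∫ x, (x - m) ^ 2 ∂ν = 1 + D := by
    rw [hν, integral_mixG hε _ _ (integrable_sub_pow_gaussianReal _ _ _)
      (integrable_sub_pow_gaussianReal _ _ _), integral_sub_sq_gaussianReal,
      integral_sub_sq_gaussianReal, hm, hD]
    ring
  have hint4 : ∫ x, (x - m) ^ 4 ∂ν ≤ C₄ := by
    rw [hν, integral_mixG hε _ _ (integrable_sub_pow_gaussianReal _ _ _)
      (integrable_sub_pow_gaussianReal _ _ _)]
    nlinarith [h4 _ _ ha, h4 _ _ hb, hε.1]
  have hv1 : Var[fun x : ℝ => x - m; ν] ≤ 2 := by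
    refine (variance_le_expectation_sq (by fun_prop)).trans ?_
    simp only [Pi.pow_apply]
    linarith
  have hv2 : Var[fun x : ℝ => (x - m) ^ 2; ν] ≤ C₄ := by
    refine (variance_le_expectation_sq (by fun_prop)).trans ?_
    simpa [← pow_mul] using hint4
  have hs : √(D / 4) ^ 2 = D / 4 := Real.sq_sqrt (by positivity)
  have hch1 := pi_sum_chebyshev ν hn0 hmem1 hv1 (s := √(D / 4)) (by positivity)
  have hch2 := pi_sum_chebyshev ν hn0 hmem2 hv2 (s := D / 2) (by positivity)
  rw [hint1, hs] at hch1
  rw [hint2] at hch2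
  have hsub : {ω : Fin n → ℝ | varStat ω ≤ varQuantile n phiG α} ⊆
      {ω | n * √(D / 4) ≤ |∑ i, (ω i - m) - n * 0|} ∪
        {ω | n * (D / 2) ≤ |∑ i, (ω i - m) ^ 2 - n * (1 + D)|} := by
    intro ω hω
    by_contra hcon
    simp only [mem_union, mem_ofPred_eq, not_or, not_le, mul_zero, sub_zero] at hcon hω
    obtain ⟨h1, h2⟩ := hcon
    have h3 := hω.trans hq
    rw [varStat, div_le_iff₀ (by linarith), sum_sub_mean_sq hn0 ω m] at h3
    have h5 : (∑ i, (ω i - m)) ^ 2 / n ≤ n * (D / 4) := by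
      rw [div_le_iff₀ (by linarith), ← hs, ← sq_abs]
      have := pow_le_pow_left₀ (abs_nonneg _) h1.le 2
      nlinarith
    have h6 := (abs_lt.1 h2).1
    nlinarith
  calc sampleMeasure n (mixG ε μ (μ + τ)) {ω | varStat ω ≤ varQuantile n phiG α}
      ≤ _ := measure_mono hsub
    _ ≤ _ := measure_union_le _ _
    _ ≤ _ := add_le_add hch1 hch2
    _ = ENNReal.ofReal (2 / (n * (D / 4)) + C₄ / (n * (D / 2) ^ 2)) :=
        (ENNReal.ofReal_add (by positivity) (by positivity)).symm
    _ ≤ _ := by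
        refine ENNReal.ofReal_le_ofReal ?_
        have e1 : 2 / (n * (D / 4)) = 8 * D / (n * D ^ 2) := by field_simp; norm_num
        have e2 : C₄ / (n * (D / 2) ^ 2) = 4 * C₄ / (n * D ^ 2) := by field_simp; norm_num
        rw [e1, e2, ← add_div]
        exact div_le_div_of_nonneg_right (by nlinarith) (by positivity)

/-- The distribution function of the standard Gaussian law. -/
def gaussCDF (x : ℝ) : ℝ := (gaussianReal 0 1).real (Iic x)

lemma phiG_pos (x : ℝ) : 0 < phiG x := by
  unfold phiG
  positivity

lemma phiG_neg (x : ℝ) : phiG (-x) = phiG x := by simp [phiG]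

lemma continuous_phiG : Continuous phiG := by
  unfold phiG
  fun_prop

lemma inv_sqrt_two_pi_le : (√(2 * Real.pi))⁻¹ ≤ 1 / 2 := by
  have h : (2 : ℝ) ≤ √(2 * Real.pi) := by
    apply Real.le_sqrt_of_sq_le
    nlinarith [Real.pi_gt_three]
  rw [one_div]
  exact inv_anti₀ (by norm_num) h

lemma phiG_le (x : ℝ) : phiG x ≤ 1 / 2 := by
  have h : Real.exp (-x ^ 2 / 2) ≤ 1 := Real.exp_le_one_iff.2 (by nlinarith [sq_nonneg x])
  have := inv_sqrt_two_pi_le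
  unfold phiG
  nlinarith [Real.exp_pos (-x ^ 2 / 2)]

lemma phiG_antitoneOn {x y : ℝ} (hx : 0 ≤ x) (hxy : x ≤ y) : phiG y ≤ phiG x := by
  unfold phiG
  gcongr

lemma integrable_phiG : Integrable phiG := by
  have := integrable_gaussianPDFReal 0 1
  convert this using 1
  ext x
  simpa using phiG_sub_eq_gaussianPDFReal 0 x

lemma gaussCDF_eq_integral (x : ℝ) : gaussCDF x = ∫ y in Iic x, phiG y := by
  rw [gaussCDF, measureReal_def, gaussianReal_apply_eq_integral _ one_ne_zero,
    ENNReal.toReal_ofReal (integral_nonneg fun y => gaussianPDFReal_nonneg _ _ _)]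
  refine integral_congr_ae (ae_of_all _ fun y => ?_)
  simpa using (phiG_sub_eq_gaussianPDFReal 0 y).symm

lemma hasDerivAt_gaussCDF (x : ℝ) : HasDerivAt gaussCDF (phiG x) x := by
  have h : gaussCDF = fun x => gaussCDF 0 + ∫ y in (0 : ℝ)..x, phiG y := by
    ext x
    rw [gaussCDF_eq_integral, gaussCDF_eq_integral,
      ← intervalIntegral.integral_Iic_sub_Iic integrable_phiG.integrableOn
        integrable_phiG.integrableOn]
    ring
  rw [h]
  exact (intervalIntegral.integral_hasDerivAt_right (continuous_phiG.intervalIntegrable _ _)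
    (continuous_phiG.stronglyMeasurableAtFilter _ _) continuous_phiG.continuousAt).const_add _

lemma hasDerivAt_phiG (x : ℝ) : HasDerivAt phiG (-x * phiG x) x := by
  have h : HasDerivAt (fun x : ℝ => -x ^ 2 / 2) (-x) x := by
    refine (((hasDerivAt_pow 2 x).neg).div_const 2).congr_deriv ?_
    push_cast
    ring
  refine (h.exp.const_mul (√(2 * Real.pi))⁻¹).congr_deriv ?_
  unfold phiG
  ring

lemma hasDerivAt_neg_mul_phiG (x : ℝ) :
    HasDerivAt (fun x => -x * phiG x) ((x ^ 2 - 1) * phiG x) x := by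
  refine ((hasDerivAt_id x).neg.mul (hasDerivAt_phiG x)).congr_deriv ?_
  simp only [Pi.neg_apply, id_eq]
  ring

lemma abs_sq_sub_one_mul_phiG_le (x : ℝ) : |(x ^ 2 - 1) * phiG x| ≤ 1 := by
  have h1 : phiG x ≤ 1 / 2 := phiG_le x
  have h2 : x ^ 2 * phiG x ≤ 1 := by
    have h3 : x ^ 2 / 2 * Real.exp (-x ^ 2 / 2) ≤ 1 := by
      have : x ^ 2 / 2 ≤ Real.exp (x ^ 2 / 2) := by linarith [Real.add_one_le_exp (x ^ 2 / 2)]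
      calc x ^ 2 / 2 * Real.exp (-x ^ 2 / 2)
          ≤ Real.exp (x ^ 2 / 2) * Real.exp (-x ^ 2 / 2) := by gcongr
        _ = 1 := by rw [← Real.exp_add]; simp [neg_div]
    have h4 : 0 ≤ x ^ 2 / 2 * Real.exp (-x ^ 2 / 2) := by positivity
    have := inv_sqrt_two_pi_le
    have e : x ^ 2 * phiG x = 2 * (√(2 * Real.pi))⁻¹ * (x ^ 2 / 2 * Real.exp (-x ^ 2 / 2)) := by
      unfold phiG; ring
    rw [e]
    nlinarith
  have h3 : 0 ≤ x ^ 2 * phiG x := mul_nonneg (sq_nonneg x) (phiG_pos x).le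
  rw [abs_le]
  constructor <;> nlinarith [phiG_pos x]

lemma abs_le_pow_succ_of_abs_deriv_le {f f' : ℝ → ℝ} (hf : ∀ h, HasDerivAt f (f' h) h)
    (h0 : f 0 = 0) {k : ℕ} (hb : ∀ h, |f' h| ≤ |h| ^ k) (h : ℝ) : |f h| ≤ |h| ^ (k + 1) := by
  have := (convex_Icc (-|h|) |h|).norm_image_sub_le_of_norm_hasDerivWithin_le
    (f := f) (f' := f') (C := |h| ^ k) (x := 0) (y := h)
    (fun x _ => (hf x).hasDerivWithinAt)
    (fun x hx => (hb x).trans (pow_le_pow_left₀ (abs_nonneg _) (abs_le.2 hx) k))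
    ⟨by simp, by simp⟩ ⟨neg_abs_le h, le_abs_self h⟩
  simpa [h0, pow_succ] using this

lemma abs_gaussCDF_taylor_le (x h : ℝ) :
    |gaussCDF (x + h) - gaussCDF x - h * phiG x + h ^ 2 * (x * phiG x) / 2| ≤ |h| ^ 3 := by
  have h1 : ∀ h, |(-(x + h) * phiG (x + h)) - (-x * phiG x)| ≤ |h| ^ 1 :=
    abs_le_pow_succ_of_abs_deriv_le (k := 0)
      (f := fun h => (-(x + h) * phiG (x + h)) - (-x * phiG x))
      (f' := fun h => ((x + h) ^ 2 - 1) * phiG (x + h))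
      (fun h => ((hasDerivAt_neg_mul_phiG (x + h)).comp_const_add x h).sub_const _) (by simp)
      (fun h => by simpa using abs_sq_sub_one_mul_phiG_le (x + h))
  have h2 : ∀ h, |phiG (x + h) - phiG x - h * (-x * phiG x)| ≤ |h| ^ 2 :=
    abs_le_pow_succ_of_abs_deriv_le (k := 1)
      (f := fun h => phiG (x + h) - phiG x - h * (-x * phiG x))
      (f' := fun h => (-(x + h) * phiG (x + h)) - (-x * phiG x))
      (fun h => by
        have := (((hasDerivAt_phiG (x + h)).comp_const_add x h).sub_const (phiG x)).sub
          ((hasDerivAt_id h).mul_const (-x * phiG x))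
        exact this.congr_deriv (by rw [one_mul])) (by simp) h1
  refine abs_le_pow_succ_of_abs_deriv_le (k := 2)
    (f := fun h => gaussCDF (x + h) - gaussCDF x - h * phiG x + h ^ 2 * (x * phiG x) / 2)
    (f' := fun h => phiG (x + h) - phiG x - h * (-x * phiG x))
    (fun h => ?_) (by simp) h2 h
  have := ((((hasDerivAt_gaussCDF (x + h)).comp_const_add x h).sub_const (gaussCDF x)).sub
    ((hasDerivAt_id h).mul_const (phiG x))).add
      (((hasDerivAt_pow 2 h).mul_const (x * phiG x)).div_const 2)
  refine this.congr_deriv ?_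
  push_cast
  ring

lemma measureReal_gaussianReal_Iio (a x : ℝ) :
    (gaussianReal a 1).real (Iio x) = gaussCDF (x - a) := by
  have := nullSingletonClass_gaussianReal (μ := a) (v := 1) one_ne_zero
  have hmap := gaussianReal_map_add_const (μ := 0) (v := 1) a
  rw [zero_add] at hmap
  rw [measureReal_congr Iio_ae_eq_Iic, ← hmap,
    map_measureReal_apply (by fun_prop) measurableSet_Iic, gaussCDF]
  congr 1
  ext y
  simp [le_sub_iff_add_le]

lemma measureReal_gaussianReal_Ioi (a x : ℝ) :
    (gaussianReal a 1).real (Ioi x) = gaussCDF (a - x) := by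
  have hmap := gaussianReal_map_neg (μ := -a) (v := 1)
  rw [neg_neg] at hmap
  rw [← hmap, map_measureReal_apply (by fun_prop) measurableSet_Ioi]
  have : (fun x : ℝ => -x) ⁻¹' Ioi x = Iio (-x) := by ext y; simp
  rw [this, measureReal_gaussianReal_Iio]
  congr 1
  ring

lemma gaussCDF_zero : gaussCDF 0 = 1 / 2 := by
  have h1 := measureReal_gaussianReal_Ioi 0 0
  have h2 : gaussCDF 0 + (gaussianReal 0 1).real (Ioi 0) = 1 := by
    have := probReal_add_probReal_compl (μ := gaussianReal 0 1) (measurableSet_Iic (a := (0 : ℝ)))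
    rwa [compl_Iic] at this
  rw [sub_zero] at h1
  linarith

lemma gaussCDF_neg_two_le : gaussCDF (-2) ≤ 1 / 8 := by
  have h := meas_ge_le_variance_div_sq (μ := gaussianReal 0 1) (X := fun x => x)
    (by simpa using memLp_sub_pow_gaussianReal 0 0 1 (p := 2)) (c := 2) (by norm_num)
  rw [variance_fun_id_gaussianReal, integral_id_gaussianReal] at h
  have h2 : (gaussianReal 0 1).real (Iio (-2) ∪ Ioi 2) ≤ 1 / 4 := by
    rw [measureReal_def]
    refine ENNReal.toReal_le_of_le_ofReal (by norm_num) ((measure_mono ?_).trans (h.trans_eq ?_))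
    · intro x hx
      rw [mem_ofPred_eq, sub_zero, le_abs]
      rcases hx with hx | hx
      · exact Or.inr (by linarith [mem_Iio.1 hx])
      · exact Or.inl (mem_Ioi.1 hx).le
    · norm_num
  rw [measureReal_union (by
      rw [Set.disjoint_left]; intro x hx hx'; simp at hx hx'; linarith) measurableSet_Ioi,
    measureReal_gaussianReal_Iio, measureReal_gaussianReal_Ioi] at h2
  norm_num at h2 ⊢
  linarith

lemma gaussCDF_sub_le {x y : ℝ} (hxy : x ≤ y) : gaussCDF y - gaussCDF x ≤ 1 / 2 * (y - x) :=
  image_sub_le_mul_sub_of_deriv_le (f := gaussCDF)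
    (fun x => (hasDerivAt_gaussCDF x).differentiableAt)
    (fun x => by rw [(hasDerivAt_gaussCDF x).deriv]; exact phiG_le x) hxy

lemma le_gaussCDF_sub {a b : ℝ} (ha : 0 ≤ a) (hab : a ≤ b) :
    phiG b * (b - a) ≤ gaussCDF (-a) - gaussCDF (-b) := by
  have := (convex_Icc (-b) (-a)).mul_sub_le_image_sub_of_le_deriv (f := gaussCDF) (C := phiG b)
    (fun x _ => (hasDerivAt_gaussCDF x).continuousAt.continuousWithinAt)
    (fun x _ => (hasDerivAt_gaussCDF x).differentiableAt.differentiableWithinAt)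
    (fun x hx => by
      rw [interior_Icc] at hx
      rw [(hasDerivAt_gaussCDF x).deriv, ← phiG_neg x]
      exact phiG_antitoneOn (by linarith [hx.2]) (by linarith [hx.1]))
    (-b) ⟨le_rfl, by linarith⟩ (-a) ⟨by linarith, le_rfl⟩ (by linarith)
  linarith

lemma exists_gaussCDF_neg_eq {p : ℝ} (hp : 1 / 8 ≤ p) (hp' : p ≤ 1 / 4) :
    ∃ t ∈ Icc (1 / 2 : ℝ) 2, gaussCDF (-t) = p := by
  have hc : ContinuousOn gaussCDF (Icc (-2) (-(1 / 2))) :=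
    fun x _ => (hasDerivAt_gaussCDF x).continuousAt.continuousWithinAt
  have h1 : 1 / 4 ≤ gaussCDF (-(1 / 2)) := by
    have := gaussCDF_sub_le (show (-(1 / 2) : ℝ) ≤ 0 by norm_num)
    rw [gaussCDF_zero] at this
    linarith
  obtain ⟨x, hx, hxp⟩ := intermediate_value_Icc (by norm_num) hc
    ⟨gaussCDF_neg_two_le.trans hp, hp'.trans h1⟩
  exact ⟨-x, ⟨by linarith [hx.2], by linarith [hx.1]⟩, by rwa [neg_neg]⟩

/-- The second-order effect of centred two-point mixing on the lower Gaussian tail. -/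
lemma gaussCDF_mixture_ge {ε : ℝ} (hε : ε ∈ Ioo (0 : ℝ) 1) (τ a : ℝ) :
    gaussCDF (-a) + ε * (1 - ε) * τ ^ 2 * (a * phiG a / 2 - |τ|) ≤
      (1 - ε) * gaussCDF (-a + ε * τ) + ε * gaussCDF (-a - (1 - ε) * τ) := by
  have hε0 := hε.1
  have hε1 : 0 < 1 - ε := by linarith [hε.2]
  have h1 := (abs_le.1 (abs_gaussCDF_taylor_le (-a) (ε * τ))).1
  have h2 := (abs_le.1 (abs_gaussCDF_taylor_le (-a) (-((1 - ε) * τ)))).1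
  rw [abs_mul, abs_of_pos hε0, phiG_neg] at h1
  rw [abs_neg, abs_mul, abs_of_pos hε1, phiG_neg, ← sub_eq_add_neg] at h2
  have h3 : ε * (1 - ε) * (ε ^ 2 + (1 - ε) ^ 2) * |τ| ^ 3 ≤ ε * (1 - ε) * |τ| ^ 3 := by
    have : ε ^ 2 + (1 - ε) ^ 2 ≤ 1 := by nlinarith
    have hp : 0 ≤ ε * (1 - ε) * |τ| ^ 3 := by positivity
    nlinarith
  have h4 : |τ| ^ 3 = τ ^ 2 * |τ| := by rw [← sq_abs τ]; ring
  nlinarith [mul_le_mul_of_nonneg_left h1 hε1.le, mul_le_mul_of_nonneg_left h2 hε0.le]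

lemma card_filter_comp_sort {n : ℕ} (ω : Fin n → ℝ) (p : ℝ → Prop) [DecidablePred p] :
    (Finset.univ.filter fun i => p ((ω ∘ Tuple.sort ω) i)).card =
      (Finset.univ.filter fun i => p (ω i)).card := by
  refine Finset.card_equiv (Tuple.sort ω) fun i => ?_
  simp

lemma oStat_lt_iff {n k : ℕ} (hk : 1 ≤ k) (hkn : k ≤ n) (ω : Fin n → ℝ) (x : ℝ) :
    oStat k ω < x ↔ k ≤ (Finset.univ.filter fun i => ω i < x).card := by
  rw [oStat, dif_pos ⟨hk, hkn⟩, ← card_filter_comp_sort ω (· < x)]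
  have := Tuple.lt_card_lt_iff_apply_lt_of_monotone (a := x) (j := (⟨k - 1, by omega⟩ : Fin n))
    (Tuple.monotone_sort ω)
  rw [Function.comp_apply] at this
  rw [← this]
  simp only
  omega

lemma lt_oStat_iff {n k : ℕ} (hk : 1 ≤ k) (hkn : k ≤ n) (ω : Fin n → ℝ) (x : ℝ) :
    x < oStat (n - k + 1) ω ↔ k ≤ (Finset.univ.filter fun i => x < ω i).card := by
  rw [← not_le, oStat, dif_pos ⟨by omega, by omega⟩]
  have h1 := Tuple.lt_card_le_iff_apply_le_of_monotone (a := x)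
    (j := (⟨n - k + 1 - 1, by omega⟩ : Fin n)) (Tuple.monotone_sort ω)
  rw [Function.comp_apply, card_filter_comp_sort ω (· ≤ x)] at h1
  rw [← h1]
  have h2 := Finset.card_filter_add_card_filter_not (s := (Finset.univ : Finset (Fin n)))
    (fun i => ω i ≤ x)
  simp only [not_le, Finset.card_univ, Fintype.card_fin] at h2 ⊢
  omega

lemma spacing_nonneg {n k : ℕ} (hk : 1 ≤ k) (hkn : 2 * k ≤ n) (ω : Fin n → ℝ) :
    0 ≤ spacing k ω := by
  rw [spacing, sub_nonneg, oStat, oStat, dif_pos ⟨by omega, by omega⟩,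
    dif_pos ⟨by omega, by omega⟩]
  exact Tuple.monotone_sort ω (Fin.mk_le_mk.2 (by omega))

lemma exists_spacing_eq {n k : ℕ} (hk : 1 ≤ k) (hkn : k ≤ n) (ω : Fin n → ℝ) :
    ∃ i j, spacing k ω = ω i - ω j := by
  rw [spacing, oStat, oStat, dif_pos ⟨by omega, by omega⟩, dif_pos ⟨by omega, by omega⟩]
  exact ⟨_, _, rfl⟩

lemma mem_Kfin_iff {n k : ℕ} (hn : 2 ≤ n) (hk : k ∈ Kfin n) : 1 ≤ k ∧ 2 * k ≤ n := by
  simp only [Kfin, Finset.mem_image, Finset.mem_range] at hk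
  obtain ⟨j, hj, rfl⟩ := hk
  refine ⟨Nat.one_le_two_pow, ?_⟩
  have h1 : 2 ^ j ≤ 2 ^ Nat.log 2 (n / 2) := Nat.pow_le_pow_right (by norm_num) (by omega)
  have h2 := Nat.pow_log_le_self 2 (show n / 2 ≠ 0 by omega)
  omega

lemma card_Kfin_pos (n : ℕ) : 0 < (Kfin n).card :=
  Finset.card_pos.2 ⟨1, by
    simp only [Kfin, Finset.mem_image, Finset.mem_range]
    exact ⟨0, by omega, rfl⟩⟩

lemma card_Kfin_le (n : ℕ) : (Kfin n).card ≤ Nat.log 2 n + 1 := by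
  refine Finset.card_image_le.trans ?_
  rw [Finset.card_range]
  have := Nat.log_mono_right (b := 2) (Nat.div_le_self n 2)
  omega

lemma exists_mem_Kfin {n : ℕ} (hn : 4 ≤ n) : ∃ k ∈ Kfin n, n ≤ 8 * k ∧ 4 * k ≤ n := by
  have h0 : 1 ≤ Nat.log 2 (n / 2) := Nat.log_pos (by norm_num) (by omega)
  obtain ⟨j, hj⟩ : ∃ j, Nat.log 2 (n / 2) = j + 1 := ⟨_, (Nat.sub_add_cancel h0).symm⟩
  refine ⟨2 ^ j, Finset.mem_image.2 ⟨j, by simp [hj], rfl⟩, ?_⟩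
  have h1 := Nat.pow_log_le_self 2 (show n / 2 ≠ 0 by omega)
  have h2 := Nat.lt_pow_succ_log_self (b := 2) (by norm_num) (n / 2)
  rw [hj] at h1 h2
  rw [pow_succ] at h1
  rw [pow_succ, pow_succ] at h2
  omega

/-- A statistic never exceeds its quantile with more than the nominal probability. -/
lemma measure_gt_sInf_quantile_le {Ω : Type*} [MeasurableSpace Ω] {P : Measure Ω}
    {X : Ω → ℝ} {u : ℝ} (hne : {t : ℝ | P {ω | X ω > t} ≤ ENNReal.ofReal u}.Nonempty) :
    P {ω | X ω > sInf {t : ℝ | P {ω | X ω > t} ≤ ENNReal.ofReal u}} ≤ ENNReal.ofReal u := by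
  set q := sInf {t : ℝ | P {ω | X ω > t} ≤ ENNReal.ofReal u} with hq
  have hlt : ∀ m : ℕ, P {ω | X ω > q + 1 / (m + 1)} ≤ ENNReal.ofReal u := by
    intro m
    obtain ⟨t, ht, htq⟩ := exists_lt_of_csInf_lt hne
      (show q < q + 1 / ((m : ℝ) + 1) by have : 0 < 1 / ((m : ℝ) + 1) := by positivity
                                         linarith)
    exact (measure_mono fun ω hω => htq.trans hω).trans ht
  have hU : {ω | X ω > q} = ⋃ m : ℕ, {ω | X ω > q + 1 / ((m : ℝ) + 1)} := by
    ext ω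
    simp only [mem_ofPred_eq, mem_iUnion, gt_iff_lt]
    constructor
    · intro h
      obtain ⟨m, hm⟩ := exists_nat_one_div_lt (sub_pos.2 h)
      exact ⟨m, by linarith⟩
    · rintro ⟨m, hm⟩
      have : 0 < 1 / ((m : ℝ) + 1) := by positivity
      linarith
  rw [hU, Monotone.measure_iUnion]
  · exact iSup_le hlt
  · intro m m' hmm ω hω
    have : 1 / ((m' : ℝ) + 1) ≤ 1 / ((m : ℝ) + 1) := Nat.one_div_le_one_div hmm
    simp only [mem_ofPred_eq, gt_iff_lt] at hω ⊢
    linarith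

lemma tendsto_measure_exists_abs_gt {n : ℕ} (P : Measure (Fin n → ℝ)) [IsFiniteMeasure P] :
    Tendsto (fun m : ℕ => P {ω | ∃ i, (m : ℝ) < |ω i|}) atTop (nhds 0) := by
  have h := tendsto_measure_iInter_atTop (μ := P)
    (s := fun m : ℕ => {ω : Fin n → ℝ | ∃ i, (m : ℝ) < |ω i|})
    (fun m => by
      have : {ω : Fin n → ℝ | ∃ i, (m : ℝ) < |ω i|} = ⋃ i, {ω | (m : ℝ) < |ω i|} := by
        ext ω; simp
      rw [this]
      exact (MeasurableSet.iUnion fun i =>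
        measurableSet_lt measurable_const (by fun_prop)).nullMeasurableSet)
    (fun m m' hmm ω ⟨i, hi⟩ => ⟨i, lt_of_le_of_lt (by exact_mod_cast hmm) hi⟩)
    ⟨0, measure_ne_top _ _⟩
  have he : (⋂ m : ℕ, {ω : Fin n → ℝ | ∃ i, (m : ℝ) < |ω i|}) = ∅ := by
    refine eq_empty_of_forall_notMem fun ω hω => ?_
    obtain ⟨m, hm⟩ := exists_nat_ge (∑ i, |ω i|)
    obtain ⟨i, hi⟩ := mem_iInter.1 hω m
    have := Finset.single_le_sum (f := fun i => |ω i|) (fun i _ => abs_nonneg _)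
      (Finset.mem_univ i)
    linarith
  rwa [he, measure_empty] at h

lemma measure_spacing_gt_quantile_le {n k : ℕ} (hk : 1 ≤ k) (hkn : k ≤ n) {u : ℝ} (hu : 0 < u) :
    sampleMeasure n phiG {ω | spacing k ω > spacingQuantile n phiG u k} ≤ ENNReal.ofReal u := by
  have := isProbabilityMeasure_sampleMeasure (n := n) (f := phiG)
  refine measure_gt_sInf_quantile_le ?_
  obtain ⟨m, hm⟩ := ((tendsto_measure_exists_abs_gt (sampleMeasure n phiG)).eventually_le_const
    (ENNReal.ofReal_pos.2 hu)).exists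
  refine ⟨2 * m, (measure_mono fun ω hω => ?_).trans hm⟩
  obtain ⟨i, j, hij⟩ := exists_spacing_eq hk hkn ω
  simp only [mem_ofPred_eq, gt_iff_lt, hij] at hω ⊢
  by_contra! hcon
  have h1 := le_abs_self (ω i)
  have h2 := neg_abs_le (ω j)
  linarith [hcon i, hcon j]

lemma le_alphaN {n : ℕ} (hn : 2 ≤ n) {α : ℝ} (hα : α ∈ Ioo (0 : ℝ) 1) :
    α / (Kfin n).card ≤ alphaN n phiG α := by
  have hK : (1 : ℝ) ≤ (Kfin n).card := by exact_mod_cast card_Kfin_pos n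
  have hu : 0 < α / (Kfin n).card := div_pos hα.1 (by linarith)
  refine le_csSup ⟨1, fun u hu => hu.1.2.le⟩ ⟨⟨hu, ?_⟩, ?_⟩
  · exact (div_le_self hα.1.le hK).trans_lt hα.2
  · have : {ω : Fin n → ℝ | ∃ k ∈ Kfin n, spacing k ω >
        spacingQuantile n phiG (α / (Kfin n).card) k} = ⋃ k ∈ Kfin n,
        {ω | spacing k ω > spacingQuantile n phiG (α / (Kfin n).card) k} := by
      ext ω; simp
    rw [this]
    calc _ ≤ _ := measure_biUnion_finset_le _ _
      _ ≤ ∑ k ∈ Kfin n, ENNReal.ofReal (α / (Kfin n).card) := by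
        refine Finset.sum_le_sum fun k hk => ?_
        have := mem_Kfin_iff hn hk
        exact measure_spacing_gt_quantile_le this.1 (by omega) hu
      _ = ENNReal.ofReal α := by
        rw [Finset.sum_const, nsmul_eq_mul, ← ENNReal.ofReal_natCast,
          ← ENNReal.ofReal_mul (by positivity), mul_div_cancel₀ _ (by positivity)]

/-- The Chebyshev inequality for empirical counts. -/
lemma pi_count_chebyshev (ν : Measure ℝ) [IsProbabilityMeasure ν] {n : ℕ} (hn : 0 < n)
    (p : ℝ → Prop) [DecidablePred p] (hp : MeasurableSet {x | p x}) {s : ℝ} (hs : 0 < s) :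
    Measure.pi (fun _ : Fin n => ν)
      {ω | n * s ≤ |((Finset.univ.filter fun i => p (ω i)).card : ℝ) - n * ν.real {x | p x}|} ≤
      ENNReal.ofReal (1 / (n * s ^ 2)) := by
  have hmeas : Measurable ({x | p x}.indicator fun _ => (1 : ℝ)) := measurable_const.indicator hp
  have hb : ∀ x, {x | p x}.indicator (fun _ => (1 : ℝ)) x ∈ Icc (0 : ℝ) 1 := fun x => by
    by_cases hx : x ∈ {x | p x} <;> simp [hx]
  have hmem : MemLp ({x | p x}.indicator fun _ => (1 : ℝ)) 2 ν :=
    memLp_indicator_const _ hp _ (Or.inr (measure_ne_top _ _))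
  have hV : Var[{x | p x}.indicator fun _ => (1 : ℝ); ν] ≤ 1 := by
    refine (variance_le_sq_of_bounded (a := 0) (b := 1) (ae_of_all _ hb)
      hmeas.aemeasurable).trans ?_
    norm_num
  have h := pi_sum_chebyshev ν hn hmem hV hs
  rw [integral_indicator_const _ hp] at h
  simpa [Finset.sum_boole, indicator_apply] using h

lemma measure_card_le_of_le (ν : Measure ℝ) [IsProbabilityMeasure ν] {n : ℕ} (hn : 0 < n)
    (p : ℝ → Prop) [DecidablePred p] (hp : MeasurableSet {x | p x}) {s : ℝ} (hs : 0 < s) {k : ℕ}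
    (hk : k ≤ n * (ν.real {x | p x} - s)) :
    Measure.pi (fun _ : Fin n => ν) {ω | (Finset.univ.filter fun i => p (ω i)).card ≤ k} ≤
      ENNReal.ofReal (1 / (n * s ^ 2)) := by
  refine (measure_mono fun ω hω => ?_).trans (pi_count_chebyshev ν hn p hp hs)
  simp only [mem_ofPred_eq] at hω ⊢
  have : ((Finset.univ.filter fun i => p (ω i)).card : ℝ) ≤ k := by exact_mod_cast hω
  rw [abs_sub_comm]
  exact le_trans (by linarith) (le_abs_self _)

lemma measure_le_card_of_le (ν : Measure ℝ) [IsProbabilityMeasure ν] {n : ℕ} (hn : 0 < n)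
    (p : ℝ → Prop) [DecidablePred p] (hp : MeasurableSet {x | p x}) {s : ℝ} (hs : 0 < s) {k : ℕ}
    (hk : n * (ν.real {x | p x} + s) ≤ k) :
    Measure.pi (fun _ : Fin n => ν) {ω | k ≤ (Finset.univ.filter fun i => p (ω i)).card} ≤
      ENNReal.ofReal (1 / (n * s ^ 2)) := by
  refine (measure_mono fun ω hω => ?_).trans (pi_count_chebyshev ν hn p hp hs)
  simp only [mem_ofPred_eq] at hω ⊢
  have : (k : ℝ) ≤ (Finset.univ.filter fun i => p (ω i)).card := by exact_mod_cast hω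
  exact le_trans (by linarith) (le_abs_self _)

lemma measure_spacing_gt_null_le {n k : ℕ} (hk : 1 ≤ k) (hkn : k ≤ n) {a s : ℝ} (hs : 0 < s)
    (h : gaussCDF (-a) + s ≤ k / n) :
    sampleMeasure n phiG {ω | spacing k ω > 2 * a} ≤ ENNReal.ofReal (2 / (n * s ^ 2)) := by
  have hn : 0 < n := by omega
  have hn' : (0 : ℝ) < n := by exact_mod_cast hn
  rw [le_div_iff₀ hn'] at h
  have h1 := measure_le_card_of_le (pdfMeasure phiG) hn (· < -a) measurableSet_Iio hs (k := k) (by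
    have : {x | x < -a} = Iio (-a) := rfl
    rw [this, pdfMeasure_phiG, measureReal_gaussianReal_Iio, sub_zero]
    linarith)
  have h2 := measure_le_card_of_le (pdfMeasure phiG) hn (a < ·) measurableSet_Ioi hs (k := k) (by
    have : {x | a < x} = Ioi a := rfl
    rw [this, pdfMeasure_phiG, measureReal_gaussianReal_Ioi, zero_sub]
    linarith)
  have hsub : {ω : Fin n → ℝ | spacing k ω > 2 * a} ⊆
      {ω | k ≤ (Finset.univ.filter fun i => ω i < -a).card} ∪
        {ω | k ≤ (Finset.univ.filter fun i => a < ω i).card} := by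
    intro ω hω
    rw [mem_union, mem_ofPred_eq, mem_ofPred_eq, ← oStat_lt_iff hk hkn, ← lt_oStat_iff hk hkn]
    by_contra! hcon
    rw [mem_ofPred_eq, spacing] at hω
    linarith [hcon.1, hcon.2]
  calc _ ≤ _ := measure_mono hsub
    _ ≤ _ := measure_union_le _ _
    _ ≤ _ := add_le_add h1 h2
    _ = _ := by
      rw [← ENNReal.ofReal_add (by positivity) (by positivity), ← add_div]
      norm_num

lemma measure_spacing_le_mixG_le {n k : ℕ} (hk : 1 ≤ k) (hkn : k ≤ n) {ε τ μ a s : ℝ}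
    (hε : ε ∈ Ioo (0 : ℝ) 1) (hs : 0 < s)
    (h : k / n + s ≤ gaussCDF (-a) + ε * (1 - ε) * τ ^ 2 * (a * phiG a / 2 - |τ|)) :
    sampleMeasure n (mixG ε μ (μ + τ)) {ω | spacing k ω ≤ 2 * a} ≤
      ENNReal.ofReal (2 / (n * s ^ 2)) := by
  have hn : 0 < n := by omega
  have hn' : (0 : ℝ) < n := by exact_mod_cast hn
  have := isProbabilityMeasure_mixG hε μ (μ + τ)
  set ν := pdfMeasure (mixG ε μ (μ + τ)) with hν
  set m := μ + ε * τ with hm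
  have hkey : ∀ F : ℝ, gaussCDF (-a) + ε * (1 - ε) * τ ^ 2 * (a * phiG a / 2 - |τ|) ≤ F →
      (k : ℝ) ≤ n * (F - s) := fun F hF => by
    have : (k : ℝ) / n ≤ F - s := by linarith
    rwa [div_le_iff₀ hn', mul_comm] at this
  have h1 := measure_card_le_of_le ν hn (· < m - a) measurableSet_Iio hs (k := k) (hkey _ (by
    have e : {x | x < m - a} = Iio (m - a) := rfl
    have e1 : m - a - μ = -a + ε * τ := by rw [hm]; ring
    have e2 : m - a - (μ + τ) = -a - (1 - ε) * τ := by rw [hm]; ring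
    rw [e, hν, measureReal_mixG hε, measureReal_gaussianReal_Iio, measureReal_gaussianReal_Iio,
      e1, e2]
    exact gaussCDF_mixture_ge hε τ a))
  have h2 := measure_card_le_of_le ν hn (m + a < ·) measurableSet_Ioi hs (k := k) (hkey _ (by
    have e : {x | m + a < x} = Ioi (m + a) := rfl
    have e1 : μ - (m + a) = -a + ε * -τ := by rw [hm]; ring
    have e2 : μ + τ - (m + a) = -a - (1 - ε) * -τ := by rw [hm]; ring
    rw [e, hν, measureReal_mixG hε, measureReal_gaussianReal_Ioi, measureReal_gaussianReal_Ioi,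
      e1, e2]
    simpa using gaussCDF_mixture_ge hε (-τ) a))
  have hsub : {ω : Fin n → ℝ | spacing k ω ≤ 2 * a} ⊆
      {ω | (Finset.univ.filter fun i => ω i < m - a).card ≤ k} ∪
        {ω | (Finset.univ.filter fun i => m + a < ω i).card ≤ k} := by
    intro ω hω
    by_contra hcon
    simp only [mem_union, mem_ofPred_eq, not_or, not_le] at hcon
    have h3 := (oStat_lt_iff hk hkn ω (m - a)).2 hcon.1.le
    have h4 := (lt_oStat_iff hk hkn ω (m + a)).2 hcon.2.le
    rw [mem_ofPred_eq, spacing] at hω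
    linarith
  calc _ ≤ _ := measure_mono hsub
    _ ≤ _ := measure_union_le _ _
    _ ≤ _ := add_le_add h1 h2
    _ = _ := by
      rw [← ENNReal.ofReal_add (by positivity) (by positivity), ← add_div]
      norm_num

lemma exists_psiReject_error_le : ∃ C c : ℝ, 0 < C ∧ 0 < c ∧ ∀ n : ℕ, 4 ≤ n → ∀ ε τ μ α D : ℝ,
    ε ∈ Ioo (0 : ℝ) 1 → 0 < τ → τ ≤ c → α ∈ Ioo (0 : ℝ) 1 → D = ε * (1 - ε) * τ ^ 2 →
    C * (Kfin n).card / (n * D ^ 2) ≤ α →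
    sampleMeasure n (mixG ε μ (μ + τ)) (psiReject n phiG α)ᶜ ≤ ENNReal.ofReal (C / (n * D ^ 2)) := by
  obtain ⟨c, hc⟩ : ∃ c, c = phiG 3 / 4 := ⟨_, rfl⟩
  have hc0 : 0 < c := by rw [hc]; linarith [phiG_pos 3]
  have hc1 : c ≤ 1 / 8 := by rw [hc]; linarith [phiG_le 3]
  refine ⟨2 / c ^ 4 + 8 / c ^ 2, c / 4, by positivity, by positivity,
    fun n hn ε τ μ α D hε hτ0 hτc hα hD hsmall => ?_⟩
  have hn0 : (0 : ℝ) < n := by exact_mod_cast (show 0 < n by omega)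
  have hε1 : 0 < 1 - ε := by linarith [hε.2]
  have hD0 : 0 < D := by rw [hD]; exact mul_pos (mul_pos hε.1 hε1) (by positivity)
  have hD1 : D ≤ 1 := by
    have : ε * (1 - ε) ≤ 1 := by nlinarith [hε.1]
    have : τ ^ 2 ≤ 1 := by nlinarith
    have := mul_pos hε.1 hε1
    rw [hD]; nlinarith
  obtain ⟨k, hkK, hk8, hk4⟩ := exists_mem_Kfin hn
  obtain ⟨hk1, hk2⟩ := mem_Kfin_iff (by omega) hkK
  obtain ⟨t, ⟨ht1, ht2⟩, ht⟩ := exists_gaussCDF_neg_eq (p := k / n)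
    (by
      rw [div_le_div_iff₀ (by norm_num) hn0]
      have : (n : ℝ) ≤ 8 * k := by exact_mod_cast hk8
      linarith)
    (by
      rw [div_le_div_iff₀ hn0 (by norm_num)]
      have : 4 * (k : ℝ) ≤ n := by exact_mod_cast hk4
      linarith)
  set s := c * D / 4 with hs
  have hs0 : 0 < s := by positivity
  have hs1 : s ≤ 1 := by rw [hs]; nlinarith
  have hnull : gaussCDF (-(t + s)) + c ^ 2 * D ≤ k / n := by
    have h1 := le_gaussCDF_sub (a := t) (b := t + s) (by linarith) (by linarith)
    have h2 : 4 * c ≤ phiG (t + s) := by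
      rw [hc]; linarith [phiG_antitoneOn (x := t + s) (y := 3) (by linarith) (by linarith)]
    rw [ht, add_sub_cancel_left] at h1
    have h3 := mul_le_mul_of_nonneg_right h2 hs0.le
    rw [hs] at h1 h3 ⊢
    nlinarith
  have halt : k / n + c * D / 2 ≤
      gaussCDF (-(t + s)) + ε * (1 - ε) * τ ^ 2 * ((t + s) * phiG (t + s) / 2 - |τ|) := by
    have h1 := gaussCDF_sub_le (show -(t + s) ≤ -t by linarith)
    have h2 : 4 * c ≤ phiG (t + s) := by
      rw [hc]; linarith [phiG_antitoneOn (x := t + s) (y := 3) (by linarith) (by linarith)]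
    have h3 : 3 * c / 4 ≤ (t + s) * phiG (t + s) / 2 - |τ| := by
      rw [abs_of_pos hτ0]; nlinarith
    have h4 := mul_le_mul_of_nonneg_left h3 hD0.le
    rw [← hD]
    rw [ht] at h1
    rw [hs] at h1 h4 ⊢
    nlinarith
  have hP0 := measure_spacing_gt_null_le hk1 (by omega) (by positivity) hnull
  have hP1 := measure_spacing_le_mixG_le (μ := μ) hk1 (by omega) hε (by positivity) halt
  have hK : (0 : ℝ) < (Kfin n).card := by exact_mod_cast card_Kfin_pos n
  have hX : 0 < (n : ℝ) * D ^ 2 := by positivity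
  have hq : spacingQuantile n phiG (alphaN n phiG α) k ≤ 2 * (t + s) := by
    have := isProbabilityMeasure_sampleMeasure (n := n) (f := phiG)
    refine sInf_quantile_le (spacing_nonneg hk1 hk2) (by linarith) (hP0.trans
      (ENNReal.ofReal_le_ofReal (le_trans ?_ (le_alphaN (by omega) hα))))
    rw [le_div_iff₀ hK]
    refine le_trans ?_ hsmall
    have e : 2 / (n * (c ^ 2 * D) ^ 2) * (Kfin n).card =
        2 / c ^ 4 * (Kfin n).card / (n * D ^ 2) := by field_simp
    rw [e]
    have : 0 ≤ 8 / c ^ 2 := by positivity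
    gcongr
    linarith
  calc _ ≤ sampleMeasure n (mixG ε μ (μ + τ)) {ω | spacing k ω ≤ 2 * (t + s)} := by
        refine measure_mono fun ω hω => ?_
        simp only [psiReject, mem_compl_iff, mem_ofPred_eq, not_exists, not_and, gt_iff_lt,
          not_lt] at hω ⊢
        exact (hω k hkK).trans hq
    _ ≤ _ := hP1
    _ ≤ _ := by
        refine ENNReal.ofReal_le_ofReal ?_
        have e : 2 / (n * (c * D / 2) ^ 2) = 8 / c ^ 2 / (n * D ^ 2) := by
          field_simp
          norm_num
        rw [e]
        have : 0 ≤ 2 / c ^ 4 := by positivity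
        gcongr
        linarith

/-- The likelihood ratio of a two-component Gaussian mixture to a Gaussian law of mean `m`. -/
def mixRatio (ε a b m x : ℝ) : ℝ :=
  (1 - ε) * Real.exp ((a - m) * (x - m) - (a - m) ^ 2 / 2) +
    ε * Real.exp ((b - m) * (x - m) - (b - m) ^ 2 / 2)

lemma mixRatio_nonneg {ε : ℝ} (hε : ε ∈ Ioo (0 : ℝ) 1) (a b m x : ℝ) : 0 ≤ mixRatio ε a b m x := by
  have h1 : 0 < 1 - ε := by linarith [hε.2]
  have h2 := hε.1
  unfold mixRatio
  positivity

lemma continuous_mixRatio (ε a b m : ℝ) : Continuous (mixRatio ε a b m) := by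
  unfold mixRatio
  fun_prop

lemma phiG_mul_exp (a m x : ℝ) :
    phiG (x - m) * Real.exp ((a - m) * (x - m) - (a - m) ^ 2 / 2) = phiG (x - a) := by
  rw [phiG, phiG, mul_assoc, ← Real.exp_add]
  ring_nf

lemma pdfMeasure_mixG_eq_withDensity (ε a b m : ℝ) :
    pdfMeasure (mixG ε a b) =
      (gaussianReal m 1).withDensity fun x => ENNReal.ofReal (mixRatio ε a b m x) := by
  have hphi : Measurable phiG := continuous_phiG.measurable
  rw [← pdfMeasure_phiG_sub, pdfMeasure, pdfMeasure, ← withDensity_mul _ (by fun_prop)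
    (continuous_mixRatio ε a b m).measurable.ennreal_ofReal]
  congr 1
  ext x
  rw [Pi.mul_apply, ← ENNReal.ofReal_mul (phiG_pos _).le, mixRatio, mul_add,
    mul_left_comm, mul_left_comm _ ε, phiG_mul_exp, phiG_mul_exp, mixG]

lemma pi_withDensity {ι : Type*} [Fintype ι] (P : Measure ℝ) [IsProbabilityMeasure P]
    {f : ℝ → ℝ≥0∞} (hf : Measurable f) [IsProbabilityMeasure (P.withDensity f)] :
    Measure.pi (fun _ : ι => P.withDensity f) =
      (Measure.pi fun _ : ι => P).withDensity fun ω => ∏ i, f (ω i) := by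
  refine Measure.pi_eq fun s hs => ?_
  rw [withDensity_apply _ (MeasurableSet.univ_pi hs), ← lintegral_indicator
    (MeasurableSet.univ_pi hs)]
  have h1 : ((univ.pi s).indicator fun ω : ι → ℝ => ∏ i, f (ω i)) =
      fun ω => ∏ i, (s i).indicator f (ω i) := by
    ext ω
    by_cases hω : ω ∈ univ.pi s
    · rw [indicator_of_mem hω]
      exact Finset.prod_congr rfl fun i _ => (indicator_of_mem (hω i (mem_univ i)) _).symm
    · rw [indicator_of_notMem hω]
      simp only [Set.mem_pi, mem_univ, forall_const, not_forall] at hω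
      obtain ⟨i, hi⟩ := hω
      exact (Finset.prod_eq_zero (Finset.mem_univ i) (indicator_of_notMem hi _)).symm
  rw [h1, lintegral_prod_eq_prod_lintegral_of_indepFun _
    (fun i (ω : ι → ℝ) => (s i).indicator f (ω i))
    (iIndepFun_pi (X := fun i => (s i).indicator f) fun i => (hf.indicator (hs i)).aemeasurable)
    fun i => (hf.indicator (hs i)).comp (measurable_pi_apply i)]
  refine Finset.prod_congr rfl fun i _ => ?_
  rw [(measurePreserving_eval (fun _ : ι => P) i).lintegral_comp (hf.indicator (hs i)),
    lintegral_indicator (hs i), withDensity_apply _ (hs i)]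

lemma integrable_exp_mul_sub_gaussianReal (c d m : ℝ) :
    Integrable (fun x => Real.exp (c * (x - m) - d)) (gaussianReal m 1) := by
  have := (integrable_exp_mul_gaussianReal (μ := m) (v := 1) c).mul_const (Real.exp (-c * m - d))
  convert this using 1
  ext x
  rw [← Real.exp_add]
  ring_nf

lemma integral_exp_mul_sub_gaussianReal (c d m : ℝ) :
    ∫ x, Real.exp (c * (x - m) - d) ∂(gaussianReal m 1) = Real.exp (c ^ 2 / 2 - d) := by
  have h : (fun x => Real.exp (c * (x - m) - d)) =
      fun x => Real.exp (c * x) * Real.exp (-c * m - d) := by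
    ext x
    rw [← Real.exp_add]
    ring_nf
  have h2 := congrFun (mgf_fun_id_gaussianReal (μ := m) (v := 1)) c
  rw [mgf] at h2
  rw [h, integral_mul_const, h2, ← Real.exp_add]
  congr 1
  push_cast
  ring

lemma integral_mixRatio (ε a b m : ℝ) : ∫ x, mixRatio ε a b m x ∂(gaussianReal m 1) = 1 := by
  unfold mixRatio
  rw [integral_add ((integrable_exp_mul_sub_gaussianReal _ _ _).const_mul _)
    ((integrable_exp_mul_sub_gaussianReal _ _ _).const_mul _), integral_const_mul,
    integral_const_mul, integral_exp_mul_sub_gaussianReal, integral_exp_mul_sub_gaussianReal]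
  simp

lemma integrable_mixRatio (ε a b m : ℝ) : Integrable (mixRatio ε a b m) (gaussianReal m 1) :=
  ((integrable_exp_mul_sub_gaussianReal _ _ _).const_mul _).add
    ((integrable_exp_mul_sub_gaussianReal _ _ _).const_mul _)

lemma mixRatio_sq (ε a b m x : ℝ) : mixRatio ε a b m x ^ 2 =
    (1 - ε) ^ 2 * Real.exp ((2 * (a - m)) * (x - m) - (a - m) ^ 2) +
    2 * ε * (1 - ε) * Real.exp ((a + b - 2 * m) * (x - m) - ((a - m) ^ 2 + (b - m) ^ 2) / 2) +
    ε ^ 2 * Real.exp ((2 * (b - m)) * (x - m) - (b - m) ^ 2) := by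
  have e1 : Real.exp ((2 * (a - m)) * (x - m) - (a - m) ^ 2) =
      Real.exp ((a - m) * (x - m) - (a - m) ^ 2 / 2) ^ 2 := by
    rw [← Real.exp_nat_mul]; push_cast; ring_nf
  have e2 : Real.exp ((2 * (b - m)) * (x - m) - (b - m) ^ 2) =
      Real.exp ((b - m) * (x - m) - (b - m) ^ 2 / 2) ^ 2 := by
    rw [← Real.exp_nat_mul]; push_cast; ring_nf
  have e3 : Real.exp ((a + b - 2 * m) * (x - m) - ((a - m) ^ 2 + (b - m) ^ 2) / 2) =
      Real.exp ((a - m) * (x - m) - (a - m) ^ 2 / 2) *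
        Real.exp ((b - m) * (x - m) - (b - m) ^ 2 / 2) := by
    rw [← Real.exp_add]; ring_nf
  rw [e1, e2, e3, mixRatio]
  ring

lemma integrable_mixRatio_sq (ε a b m : ℝ) :
    Integrable (fun x => mixRatio ε a b m x ^ 2) (gaussianReal m 1) := by
  simp only [mixRatio_sq]
  exact (((integrable_exp_mul_sub_gaussianReal _ _ _).const_mul _).add
    ((integrable_exp_mul_sub_gaussianReal _ _ _).const_mul _)).add
    ((integrable_exp_mul_sub_gaussianReal _ _ _).const_mul _)

lemma integral_mixRatio_sq (ε a b m : ℝ) :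
    ∫ x, mixRatio ε a b m x ^ 2 ∂(gaussianReal m 1) =
      (1 - ε) ^ 2 * Real.exp ((a - m) ^ 2) + 2 * ε * (1 - ε) * Real.exp ((a - m) * (b - m)) +
        ε ^ 2 * Real.exp ((b - m) ^ 2) := by
  have hi : ∀ C c d, Integrable (fun x => C * Real.exp (c * (x - m) - d)) (gaussianReal m 1) :=
    fun C c d => (integrable_exp_mul_sub_gaussianReal c d m).const_mul C
  have hi2 : ∀ C c d C' c' d', Integrable (fun x => C * Real.exp (c * (x - m) - d) +
      C' * Real.exp (c' * (x - m) - d')) (gaussianReal m 1) :=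
    fun C c d C' c' d' => (hi C c d).add (hi C' c' d')
  simp only [mixRatio_sq]
  rw [integral_add (hi2 _ _ _ _ _ _) (hi _ _ _), integral_add (hi _ _ _) (hi _ _ _)]
  simp only [integral_const_mul, integral_exp_mul_sub_gaussianReal]
  ring_nf

/-- The chi-square divergence of a Gaussian mixture from the Gaussian law with the same mean is of
the order of the squared excess variance. -/
lemma integral_mixRatio_sq_le {ε τ : ℝ} (hε : ε ∈ Ioo (0 : ℝ) 1) (hτ0 : 0 < τ) (hτ1 : τ ≤ 1)
    (μ : ℝ) : ∫ x, mixRatio ε μ (μ + τ) (μ + ε * τ) x ^ 2 ∂(gaussianReal (μ + ε * τ) 1) ≤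
      1 + (ε * (1 - ε) * τ ^ 2) ^ 2 := by
  have hε0 := hε.1
  have hε1 : 0 < 1 - ε := by linarith [hε.2]
  have hexp : ∀ x : ℝ, |x| ≤ 1 → Real.exp x ≤ 1 + x + x ^ 2 := fun x hx => by
    have := (abs_le.1 (Real.abs_exp_sub_one_sub_id_le hx)).2
    linarith
  have hb : ∀ c : ℝ, 0 ≤ c → c ≤ 1 → |c * τ ^ 2| ≤ 1 := fun c hc0 hc1 => by
    rw [abs_of_nonneg (by positivity)]
    exact mul_le_one₀ hc1 (by positivity) (pow_le_one₀ hτ0.le hτ1)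
  have e1 : (μ - (μ + ε * τ)) ^ 2 = ε ^ 2 * τ ^ 2 := by ring
  have e2 : (μ - (μ + ε * τ)) * (μ + τ - (μ + ε * τ)) = -(ε * (1 - ε) * τ ^ 2) := by ring
  have e3 : (μ + τ - (μ + ε * τ)) ^ 2 = (1 - ε) ^ 2 * τ ^ 2 := by ring
  rw [integral_mixRatio_sq, e1, e2, e3]
  have h1 := hexp _ (hb (ε ^ 2) (by positivity) (by nlinarith))
  have h2 := hexp (-(ε * (1 - ε) * τ ^ 2)) (by
    rw [abs_neg]; exact hb _ (by positivity) (by nlinarith))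
  have h3 := hexp _ (hb ((1 - ε) ^ 2) (by positivity) (by nlinarith))
  have p2 : 0 ≤ 2 * ε * (1 - ε) := by positivity
  nlinarith [mul_le_mul_of_nonneg_left h1 (sq_nonneg (1 - ε)), mul_le_mul_of_nonneg_left h2 p2,
    mul_le_mul_of_nonneg_left h3 (sq_nonneg ε)]

/-- The second moment bound of Le Cam: an event has at most slightly larger probability under the
mixture than under the Gaussian law with the same mean. -/
lemma sampleMeasure_mixG_le {ε τ : ℝ} (hε : ε ∈ Ioo (0 : ℝ) 1) (hτ0 : 0 < τ) (hτ1 : τ ≤ 1) (μ : ℝ)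
    {n : ℕ} {A : Set (Fin n → ℝ)} (hA : MeasurableSet A) {α η : ℝ} (hα : 0 ≤ α) (hη : 0 < η)
    (h : sampleMeasure n (fun x => phiG (x - (μ + ε * τ))) A ≤ ENNReal.ofReal α) :
    (sampleMeasure n (mixG ε μ (μ + τ))).real A ≤
      α + η + ((1 + (ε * (1 - ε) * τ ^ 2) ^ 2) ^ n - 1) / (4 * η) := by
  have hprob := isProbabilityMeasure_mixG hε μ (μ + τ)
  set m := μ + ε * τ with hm
  set L := mixRatio ε μ (μ + τ) m with hL
  have hL0 : ∀ x, 0 ≤ L x := mixRatio_nonneg hε _ _ _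
  rw [sampleMeasure, pdfMeasure_phiG_sub] at h
  have hD := pdfMeasure_mixG_eq_withDensity ε μ (μ + τ) m
  rw [hD] at hprob
  rw [sampleMeasure, hD, pi_withDensity _ (continuous_mixRatio _ _ _ _).measurable.ennreal_ofReal]
  set P := Measure.pi fun _ : Fin n => gaussianReal m 1 with hP
  have hi1 : Integrable (fun ω : Fin n → ℝ => ∏ i, L (ω i)) P :=
    Integrable.fintype_prod fun _ => integrable_mixRatio _ _ _ _
  have hi2 : Integrable (fun ω : Fin n → ℝ => ∏ i, L (ω i) ^ 2) P :=
    Integrable.fintype_prod (f := fun _ x => L x ^ 2) fun _ => integrable_mixRatio_sq _ _ _ _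
  have hE1 : ∫ ω : Fin n → ℝ, ∏ i, L (ω i) ∂P = 1 := by
    rw [hP, integral_fintype_prod_eq_pow, hL, integral_mixRatio, one_pow]
  have hE2 : ∫ ω : Fin n → ℝ, ∏ i, L (ω i) ^ 2 ∂P ≤ (1 + (ε * (1 - ε) * τ ^ 2) ^ 2) ^ n := by
    rw [hP, integral_fintype_prod_eq_pow (fun x => L x ^ 2), Fintype.card_fin]
    exact pow_le_pow_left₀ (integral_nonneg fun x => sq_nonneg _)
      (integral_mixRatio_sq_le hε hτ0 hτ1 μ) n
  have hQ : (P.withDensity fun ω => ∏ i, ENNReal.ofReal (L (ω i))).real A =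
      ∫ ω in A, ∏ i, L (ω i) ∂P := by
    rw [measureReal_def, withDensity_apply _ hA, integral_eq_lintegral_of_nonneg_ae
      (ae_of_all _ fun ω => Finset.prod_nonneg fun i _ => hL0 _) hi1.integrableOn.1]
    congr 1
    refine lintegral_congr fun ω => ?_
    rw [ENNReal.ofReal_prod_of_nonneg fun i _ => hL0 _]
  rw [hQ]
  set g : (Fin n → ℝ) → ℝ := fun ω =>
    η + (∏ i, L (ω i) ^ 2 - 2 * ∏ i, L (ω i) + 1) / (4 * η) with hg
  have hi3 : Integrable (fun ω : Fin n → ℝ => ∏ i, L (ω i) ^ 2 - 2 * ∏ i, L (ω i)) P :=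
    hi2.sub (hi1.const_mul 2)
  have hi4 : Integrable (fun ω : Fin n → ℝ => ∏ i, L (ω i) ^ 2 - 2 * ∏ i, L (ω i) + 1) P :=
    hi3.add (integrable_const _)
  have hgi : Integrable g P := (integrable_const _).add (hi4.div_const _)
  have hamgm : ∀ ω : Fin n → ℝ, ∏ i, L (ω i) - 1 ≤ g ω := fun ω => by
    simp only [hg, Finset.prod_pow]
    set y := ∏ i, L (ω i)
    have : y - 1 - η ≤ (y ^ 2 - 2 * y + 1) / (4 * η) := by
      rw [le_div_iff₀ (by positivity)]
      nlinarith [sq_nonneg (y - 1 - 2 * η)]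
    linarith
  have hg0 : ∀ ω, 0 ≤ g ω := fun ω => by
    simp only [hg, Finset.prod_pow]
    set y := ∏ i, L (ω i)
    have : 0 ≤ y ^ 2 - 2 * y + 1 := by nlinarith [sq_nonneg (y - 1)]
    positivity
  calc ∫ ω in A, ∏ i, L (ω i) ∂P ≤ ∫ ω in A, (1 + g ω) ∂P :=
        setIntegral_mono hi1.integrableOn ((integrable_const _).add hgi).integrableOn
          fun ω => by linarith [hamgm ω]
    _ = P.real A + ∫ ω in A, g ω ∂P := by
        rw [integral_add (integrable_const _).integrableOn hgi.integrableOn]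
        simp
    _ ≤ α + ∫ ω, g ω ∂P := by
        refine add_le_add (ENNReal.toReal_le_of_le_ofReal hα h)
          (setIntegral_le_integral hgi (ae_of_all _ hg0))
    _ ≤ _ := by
        have : ∫ ω, g ω ∂P = η + (∫ ω, ∏ i, L (ω i) ^ 2 ∂P - 2 * 1 + 1) / (4 * η) := by
          simp only [hg]
          rw [integral_add (integrable_const _) (hi4.div_const _), integral_div,
            integral_add hi3 (integrable_const _),
            integral_sub hi2 (hi1.const_mul 2), integral_const_mul, hE1]
          simp
        rw [this, add_assoc α]
        gcongr
        linarith

lemma tendsto_zero_of_mul_rpow {u : ℕ → ℝ} {s : ℝ} (hs : 0 < s)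
    (h : Tendsto (fun n : ℕ => u n * (n : ℝ) ^ s) atTop (nhds 1)) :
    Tendsto u atTop (nhds 0) := by
  have h2 : Tendsto (fun n : ℕ => (n : ℝ) ^ (-s)) atTop (nhds 0) :=
    (tendsto_rpow_neg_atTop hs).comp tendsto_natCast_atTop_atTop
  have h3 := h.mul h2
  rw [mul_zero] at h3
  refine h3.congr' ?_
  filter_upwards [eventually_gt_atTop 0] with n hn
  rw [mul_assoc, ← Real.rpow_add (by exact_mod_cast hn)]
  simp

/-- The squared excess variance of the mixture, normalised by its asymptotic order. -/
lemma tendsto_excess_sq {ε τ : ℕ → ℝ} {δ r : ℝ} (hδ : 0 < δ)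
    (hε : Tendsto (fun n : ℕ => ε n * (n : ℝ) ^ δ) atTop (nhds 1))
    (hτ : Tendsto (fun n : ℕ => τ n * (n : ℝ) ^ r) atTop (nhds 1)) :
    Tendsto (fun n : ℕ => n * (ε n * (1 - ε n) * τ n ^ 2) ^ 2 *
      (n : ℝ) ^ (-(1 - 2 * δ - 4 * r))) atTop (nhds 1) := by
  have h0 := tendsto_zero_of_mul_rpow hδ hε
  have h1 : Tendsto (fun n => 1 - ε n) atTop (nhds 1) := by
    simpa using tendsto_const_nhds.sub h0
  have h2 := ((hε.mul h1).mul (hτ.pow 2)).pow 2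
  norm_num at h2
  refine h2.congr' ?_
  filter_upwards [eventually_gt_atTop 0] with n hn
  have hn' : (0 : ℝ) < n := by exact_mod_cast hn
  have e : (n : ℝ) * (n : ℝ) ^ (-(1 - 2 * δ - 4 * r)) = ((n : ℝ) ^ δ) ^ 2 * ((n : ℝ) ^ r) ^ 4 := by
    rw [← Real.rpow_natCast, ← Real.rpow_natCast, ← Real.rpow_mul hn'.le, ← Real.rpow_mul hn'.le,
      ← Real.rpow_add hn']
    nth_rewrite 1 [← Real.rpow_one (n : ℝ)]
    rw [← Real.rpow_add hn']
    congr 1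
    push_cast
    ring
  linear_combination (-(ε n * (1 - ε n) * τ n ^ 2) ^ 2) * e

lemma tendsto_natLog_add_one_mul_rpow {s : ℝ} (hs : 0 < s) :
    Tendsto (fun n : ℕ => ((Nat.log 2 n : ℝ) + 1) * (n : ℝ) ^ (-s)) atTop (nhds 0) := by
  have h1 : Tendsto (fun n : ℕ => (n : ℝ) ^ (-s)) atTop (nhds 0) :=
    (tendsto_rpow_neg_atTop hs).comp tendsto_natCast_atTop_atTop
  have h2 : Tendsto (fun n : ℕ => Real.log n / (n : ℝ) ^ s) atTop (nhds 0) :=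
    ((isLittleO_log_rpow_atTop hs).tendsto_div_nhds_zero).comp tendsto_natCast_atTop_atTop
  have h3 := (h2.mul_const (Real.log 2)⁻¹).add h1
  rw [zero_mul, zero_add] at h3
  refine squeeze_zero (fun n => by positivity) (fun n => ?_) h3
  have h4 : (Nat.log 2 n : ℝ) ≤ Real.log n * (Real.log 2)⁻¹ := by
    simpa [Real.logb, div_eq_mul_inv] using Real.natLog_le_logb n 2
  rw [add_mul, one_mul, Real.rpow_neg (Nat.cast_nonneg n), div_eq_mul_inv, mul_right_comm]
  gcongr

/-- dense-regime detection boundary `r*(δ) = 1/4 - δ/2` in the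
Gaussian case (Corollary `dense`). -/
theorem stmt3 (α β δ r : ℝ)
    (hα : α ∈ Set.Ioo (0:ℝ) 1) (hβ : β ∈ Set.Ioo (0:ℝ) (1 - α))
    (hδ0 : 0 < δ) (hδ : δ ≤ 1 / 2) (hr0 : 0 < r) (hr : r < 1 / 2)
    (ε τ μ₁ : ℕ → ℝ)
    (hε : ∀ n, ε n ∈ Set.Ioo (0:ℝ) 1) (hτ : ∀ n, 0 < τ n)
    (hεlim : Filter.Tendsto (fun n : ℕ => ε n * (n : ℝ) ^ δ) Filter.atTop (nhds 1))
    (hτlim : Filter.Tendsto (fun n : ℕ => τ n * (n : ℝ) ^ r) Filter.atTop (nhds 1)) :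
    -- detection is possible below the boundary, with both tests
    (r < 1 / 4 - δ / 2 →
      ∀ᶠ n : ℕ in Filter.atTop,
        sampleMeasure n (mixG (ε n) (μ₁ n) (μ₁ n + τ n)) (psiReject n phiG α)ᶜ
            ≤ ENNReal.ofReal β ∧
        sampleMeasure n (mixG (ε n) (μ₁ n) (μ₁ n + τ n))
            {ω | varStat ω ≤ varQuantile n phiG α} ≤ ENNReal.ofReal β) ∧
    -- detection is impossible above the boundary
    (r > 1 / 4 - δ / 2 →
      ∀ T : (n : ℕ) → (Fin n → ℝ) → Bool,
        (∀ n, Measurable (T n)) →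
        (∀ n, ∀ μ : ℝ,
          sampleMeasure n (fun x => phiG (x - μ)) {ω | T n ω = true} ≤ ENNReal.ofReal α) →
        ¬ (∀ᶠ n : ℕ in Filter.atTop,
            sampleMeasure n (mixG (ε n) (μ₁ n) (μ₁ n + τ n)) {ω | T n ω = false}
              ≤ ENNReal.ofReal β)) := by
  have hE := tendsto_excess_sq hδ0 hεlim hτlim
  have hτ0 := tendsto_zero_of_mul_rpow hr0 hτlim
  set E : ℕ → ℝ := fun n => n * (ε n * (1 - ε n) * τ n ^ 2) ^ 2 with hEdef
  have hD : ∀ n, 0 < ε n * (1 - ε n) * τ n ^ 2 := fun n => by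
    have h1 := (hε n).1
    have h2 : 0 < 1 - ε n := by linarith [(hε n).2]
    have h3 := hτ n
    positivity
  constructor
  · intro hlt
    obtain ⟨C, c, hC, hc, hpsi⟩ := exists_psiReject_error_le
    obtain ⟨C', hC', hvar⟩ := exists_varStat_error_le
    have hs : 0 < 1 - 2 * δ - 4 * r := by linarith
    have hlog : Tendsto (fun n : ℕ => ((Nat.log 2 n : ℝ) + 1) / E n) atTop (nhds 0) := by
      have := (tendsto_natLog_add_one_mul_rpow hs).div hE one_ne_zero
      rw [zero_div] at this
      refine this.congr' ?_
      filter_upwards [eventually_gt_atTop 0] with n hn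
      have hn' : (0 : ℝ) < n := by exact_mod_cast hn
      exact mul_div_mul_right _ _ (Real.rpow_pos_of_pos hn' _).ne'
    have hsmall : ∀ K b : ℝ, 0 < b → ∀ᶠ n : ℕ in atTop, K * (((Nat.log 2 n : ℝ) + 1) / E n) ≤ b :=
      fun K b hb => by
        have := hlog.const_mul K
        rw [mul_zero] at this
        exact this.eventually_le_const hb
    filter_upwards [eventually_ge_atTop 4, hτ0.eventually_le_const hc,
      hτ0.eventually_le_const one_pos, hsmall C α hα.1, hsmall C β hβ.1, hsmall C' α hα.1,
      hsmall C' β hβ.1] with n hn hτc hτ1 h1 h2 h3 h4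
    have hEn : 0 < E n := by
      have h5 := hD n
      have : (0 : ℝ) < n := by exact_mod_cast (by omega : 0 < n)
      positivity
    have hle : ∀ K b k : ℝ, 0 ≤ K → k ≤ (Nat.log 2 n : ℝ) + 1 →
        K * (((Nat.log 2 n : ℝ) + 1) / E n) ≤ b → K * k / E n ≤ b := fun K b k hK hk h => by
      refine le_trans ?_ h
      rw [mul_div_assoc]
      gcongr
    have hle' : ∀ K b : ℝ, 0 ≤ K → K * (((Nat.log 2 n : ℝ) + 1) / E n) ≤ b → K / E n ≤ b :=
      fun K b hK h => by simpa using hle K b 1 hK (by linarith [(Nat.log 2 n).cast_nonneg (α := ℝ)]) h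
    exact ⟨(hpsi n hn _ _ _ α _ (hε n) (hτ n) hτc hα rfl
        (hle C α _ hC.le (by exact_mod_cast card_Kfin_le n) h1)).trans
        (ENNReal.ofReal_le_ofReal (hle' C β hC.le h2)),
      (hvar n (by omega) _ _ _ α _ (hε n) (hτ n) hτ1 hα.2 rfl (hle' C' α hC'.le h3)).trans
        (ENNReal.ofReal_le_ofReal (hle' C' β hC'.le h4))⟩
  · intro hgt T hT hlevel herr
    have hs : 0 < -(1 - 2 * δ - 4 * r) := by linarith
    have hE0 := tendsto_zero_of_mul_rpow hs hE
    obtain ⟨η, hη⟩ : ∃ η, η = (1 - α - β) / 3 := ⟨_, rfl⟩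
    have hη0 : 0 < η := by rw [hη]; linarith [hβ.2]
    have hexp : Tendsto (fun n => (Real.exp (E n) - 1) / (4 * η)) atTop (nhds 0) := by
      have := (((Real.continuous_exp.tendsto 0).comp hE0).sub_const 1).div_const (4 * η)
      simpa using this
    obtain ⟨n, hn, hτ1, hsm⟩ := (herr.and ((hτ0.eventually_le_const one_pos).and
      (hexp.eventually_le_const hη0))).exists
    have hA : MeasurableSet {ω | T n ω = true} := hT n (measurableSet_singleton true)
    have hbound := sampleMeasure_mixG_le (hε n) (hτ n) hτ1 (μ₁ n) hA hα.1.le hη0 (hlevel n _)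
    have hpow : (1 + (ε n * (1 - ε n) * τ n ^ 2) ^ 2) ^ n ≤ Real.exp (E n) := by
      rw [hEdef, Real.exp_nat_mul]
      refine pow_le_pow_left₀ (by positivity) ?_ n
      linarith [Real.add_one_le_exp ((ε n * (1 - ε n) * τ n ^ 2) ^ 2)]
    have hdiv : ((1 + (ε n * (1 - ε n) * τ n ^ 2) ^ 2) ^ n - 1) / (4 * η) ≤
        (Real.exp (E n) - 1) / (4 * η) := by gcongr
    have := isProbabilityMeasure_mixG (hε n) (μ₁ n) (μ₁ n + τ n)
    have := isProbabilityMeasure_sampleMeasure (n := n) (f := mixG (ε n) (μ₁ n) (μ₁ n + τ n))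
    have hcompl : {ω | T n ω = false} = {ω | T n ω = true}ᶜ := by
      ext ω
      simp
    have hreal := ENNReal.toReal_le_of_le_ofReal hβ.1.le hn
    rw [← measureReal_def, hcompl, probReal_compl_eq_one_sub hA] at hreal
    linarith
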